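/- Let m ≥ 3 and let $₁ = ⟨1, c₂, c₃⟩, $₂ = ⟨1, c₂, c₃, …, c_m⟩ and $₃ = ⟨1, c₂, c₃, …, c_m, c_{m+1}⟩ be three tight coin systems such that $₁ is canonical but $₂ and $₃ are both non-canonical. If $₃ has no counterexample x of the form x = c_m + c_i > c_{m+1} or x = c_{m−1} + c_j > c_{m+1} with 1 < c_i, c_j ≤ c_m, then the smallest counterexample of $₃ is the sum of two coins of $₃. -/

import Mathlib

/-- A coin system `⟨c 1, c 2, …, c m⟩` is a strictly increasing finite sequence of
positive integers with `c 1 = 1` (only the values `c i` for `1 ≤ i ≤ m` matter). -/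
def IsCoinSystem (m : ℕ) (c : ℕ → ℕ) : Prop :=
  c 1 = 1 ∧ ∀ i j, 1 ≤ i → i < j → j ≤ m → c i < c j

/-- `α` is a representation of `x` under the coin system `⟨c 1, …, c m⟩`. -/
def IsRepr (m : ℕ) (c : ℕ → ℕ) (x : ℕ) (α : ℕ → ℕ) : Prop :=
  ∑ i ∈ Finset.Icc 1 m, α i * c i = x

/-- The size of a representation, i.e. the total number of coins used. -/
def reprSize (m : ℕ) (α : ℕ → ℕ) : ℕ :=
  ∑ i ∈ Finset.Icc 1 m, α i

/-- `α` is the greedy representation of `x`: a representation such that for every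
`2 ≤ i ≤ m` the part of the sum using coins smaller than `c i` is `< c i`. -/
def IsGreedy (m : ℕ) (c : ℕ → ℕ) (x : ℕ) (α : ℕ → ℕ) : Prop :=
  IsRepr m c x α ∧
    ∀ i, 2 ≤ i → i ≤ m → ∑ j ∈ Finset.Icc 1 (i - 1), α j * c j < c i

/-- `α` is an optimal (minimum-size) representation of `x`. -/
def IsOpt (m : ℕ) (c : ℕ → ℕ) (x : ℕ) (α : ℕ → ℕ) : Prop :=
  IsRepr m c x α ∧ ∀ β, IsRepr m c x β → reprSize m α ≤ reprSize m β

/-- `x` is a counterexample: the greedy representation of `x` is strictly larger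
than some representation of `x` (equivalently, than an optimal one). -/
def IsCounterexample (m : ℕ) (c : ℕ → ℕ) (x : ℕ) : Prop :=
  ∃ γ β, IsGreedy m c x γ ∧ IsRepr m c x β ∧ reprSize m β < reprSize m γ

/-- A coin system is non-canonical if it has a counterexample. -/
def NonCanonical (m : ℕ) (c : ℕ → ℕ) : Prop :=
  ∃ x, IsCounterexample m c x

/-- A coin system is canonical if `|GRD(x)| = |OPT(x)|` for all `x`,
i.e. it has no counterexample. -/
def IsCanonical (m : ℕ) (c : ℕ → ℕ) : Prop :=
  ∀ x, ¬ IsCounterexample m c x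

/-- A coin system is tight if it has no counterexample smaller than its largest coin. -/
def Tight (m : ℕ) (c : ℕ → ℕ) : Prop :=
  ∀ x, x < c m → ¬ IsCounterexample m c x

/-- `x` is the smallest counterexample of the coin system. -/
def SmallestCounterexample (m : ℕ) (c : ℕ → ℕ) (x : ℕ) : Prop :=
  IsCounterexample m c x ∧ ∀ y, y < x → ¬ IsCounterexample m c y

/-- `x` is a sum of `k` coins of `⟨c 1, …, c n⟩`. -/
def IsSumOf (n : ℕ) (c : ℕ → ℕ) (x k : ℕ) : Prop :=
  ∃ β, IsRepr n c x β ∧ reprSize n β = k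

/-- `c j` is the largest coin of `⟨c 1, …, c n⟩` not exceeding `x`. -/
def IsTopCoin (n : ℕ) (c : ℕ → ℕ) (x j : ℕ) : Prop :=
  1 ≤ j ∧ j ≤ n ∧ c j ≤ x ∧ ∀ i, j < i → i ≤ n → x < c i

/-- `x` has a greedy representation with `k` coins. -/
def IsGreedySum (n : ℕ) (c : ℕ → ℕ) (x k : ℕ) : Prop :=
  ∃ γ, IsGreedy n c x γ ∧ reprSize n γ = k

section

variable {n : ℕ} {c : ℕ → ℕ}

lemma IsCoinSystem.lt (hc : IsCoinSystem n c) {i j : ℕ} (hi : 1 ≤ i) (hij : i < j)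
    (hj : j ≤ n) : c i < c j :=
  hc.2 i j hi hij hj

lemma IsCoinSystem.le (hc : IsCoinSystem n c) {i j : ℕ} (hi : 1 ≤ i) (hij : i ≤ j)
    (hj : j ≤ n) : c i ≤ c j := by
  rcases hij.eq_or_lt with rfl | h
  · exact le_rfl
  · exact (hc.lt hi h hj).le

lemma IsCoinSystem.pos (hc : IsCoinSystem n c) {i : ℕ} (hi : 1 ≤ i) (hin : i ≤ n) :
    0 < c i :=
  Nat.lt_of_lt_of_le (by simp [hc.1]) (hc.le le_rfl hi hin)

lemma IsCoinSystem.mono (hc : IsCoinSystem n c) {k : ℕ} (hk : k ≤ n) : IsCoinSystem k c :=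
  ⟨hc.1, fun _ _ hi hij hj => hc.lt hi hij (hj.trans hk)⟩

lemma isTopCoin_last (hn : 1 ≤ n) {x : ℕ} (hx : c n ≤ x) : IsTopCoin n c x n :=
  ⟨hn, le_rfl, hx, fun _ h h' => absurd h' (by omega)⟩

lemma exists_isTopCoin {x w : ℕ} (hw : 1 ≤ w) (hwn : w ≤ n) (hx : c w ≤ x) :
    ∃ j, w ≤ j ∧ IsTopCoin n c x j := by
  classical
  have hP : w ≤ n ∧ c w ≤ x := ⟨hwn, hx⟩
  have hspec := Nat.findGreatest_spec (P := fun i => i ≤ n ∧ c i ≤ x) hwn hP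
  have hle := Nat.le_findGreatest (P := fun i => i ≤ n ∧ c i ≤ x) hwn hP
  refine ⟨_, hle, hw.trans hle, hspec.1, hspec.2, fun i hi hin => ?_⟩
  by_contra! h
  exact Nat.findGreatest_is_greatest hi hin ⟨hin, h⟩

lemma sum_update_add {f g : ℕ → ℕ} {j k : ℕ} (hj : 1 ≤ j) (hk : j ≤ k) :
    ∑ i ∈ Finset.Icc 1 k, (f + Pi.single j 1 : ℕ → ℕ) i * g i =
      ∑ i ∈ Finset.Icc 1 k, f i * g i + g j := by
  simp only [Pi.add_apply, add_mul, Finset.sum_add_distrib, Pi.single_apply, ite_mul, one_mul,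
    zero_mul, Finset.sum_ite_eq', Finset.mem_Icc, hj, hk, and_self, if_true]

lemma sum_update_of_lt {f g : ℕ → ℕ} {j k : ℕ} (hk : k < j) :
    ∑ i ∈ Finset.Icc 1 k, (f + Pi.single j 1 : ℕ → ℕ) i * g i = ∑ i ∈ Finset.Icc 1 k, f i * g i := by
  refine Finset.sum_congr rfl fun i hi => ?_
  have : i ≠ j := by have := (Finset.mem_Icc.1 hi).2; omega
  simp [this]

lemma isRepr_add_single {f : ℕ → ℕ} {j x : ℕ} (hj : 1 ≤ j) (hjn : j ≤ n) :
    IsRepr n c (x + c j) (f + Pi.single j 1) ↔ IsRepr n c x f := by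
  unfold IsRepr
  rw [sum_update_add hj hjn]
  omega

lemma reprSize_add_single {f : ℕ → ℕ} {j : ℕ} (hj : 1 ≤ j) (hjn : j ≤ n) :
    reprSize n (f + Pi.single j 1) = reprSize n f + 1 := by
  simpa [reprSize] using sum_update_add (f := f) (g := fun _ => 1) hj hjn

lemma eq_sub_add_single {f : ℕ → ℕ} {j : ℕ} (h : f j ≠ 0) :
    f = (f - Pi.single j 1) + Pi.single j 1 := by
  funext i
  by_cases hij : i = j
  · subst hij; simp; omega
  · simp [hij]

lemma isSumOf_zero : IsSumOf n c 0 0 := ⟨0, by simp [IsRepr], by simp [reprSize]⟩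

lemma IsSumOf.add {x y k l : ℕ} (hx : IsSumOf n c x k) (hy : IsSumOf n c y l) :
    IsSumOf n c (x + y) (k + l) := by
  obtain ⟨f, rfl, rfl⟩ := hx
  obtain ⟨g, rfl, rfl⟩ := hy
  exact ⟨f + g, by simp [IsRepr, add_mul, Finset.sum_add_distrib],
    by simp [reprSize, Finset.sum_add_distrib]⟩

lemma isSumOf_coin {j : ℕ} (hj : 1 ≤ j) (hjn : j ≤ n) : IsSumOf n c (c j) 1 := by
  refine ⟨0 + Pi.single j 1, ?_, ?_⟩
  · simpa using (isRepr_add_single (c := c) (f := 0) (x := 0) hj hjn).2 (by simp [IsRepr])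
  · rw [reprSize_add_single hj hjn]; simp [reprSize]

lemma IsSumOf.eq_zero {x : ℕ} (h : IsSumOf n c x 0) : x = 0 := by
  obtain ⟨f, rfl, hf⟩ := h
  rw [reprSize, Finset.sum_eq_zero_iff] at hf
  exact Finset.sum_eq_zero fun i hi => by simp [hf i hi]

lemma IsSumOf.exists_coin {x k : ℕ} (h : IsSumOf n c x (k + 1)) :
    ∃ i, 1 ≤ i ∧ i ≤ n ∧ c i ≤ x ∧ IsSumOf n c (x - c i) k := by
  obtain ⟨f, hf, hk⟩ := h
  obtain ⟨i, hi, hfi⟩ : ∃ i ∈ Finset.Icc 1 n, f i ≠ 0 := by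
    by_contra! h0
    rw [reprSize, Finset.sum_eq_zero h0] at hk
    omega
  obtain ⟨h1, h2⟩ := Finset.mem_Icc.1 hi
  have hle : c i ≤ x := by
    rw [← hf]
    exact (Nat.le_mul_of_pos_left _ (Nat.pos_of_ne_zero hfi)).trans
      (Finset.single_le_sum (f := fun i => f i * c i) (fun _ _ => Nat.zero_le _) hi)
  rw [eq_sub_add_single hfi] at hf hk
  rw [reprSize_add_single h1 h2] at hk
  rw [← Nat.sub_add_cancel hle, isRepr_add_single h1 h2] at hf
  exact ⟨i, h1, h2, hle, _, hf, by omega⟩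

lemma IsSumOf.pos (hc : IsCoinSystem n c) {x k : ℕ} (h : IsSumOf n c x (k + 1)) : 0 < x := by
  obtain ⟨i, h1, h2, h3, -⟩ := h.exists_coin
  have := hc.pos h1 h2
  omega

lemma IsSumOf.exists_eq {x : ℕ} (h : IsSumOf n c x 1) : ∃ i, 1 ≤ i ∧ i ≤ n ∧ x = c i := by
  obtain ⟨i, h1, h2, h3, h4⟩ := h.exists_coin
  have := h4.eq_zero
  exact ⟨i, h1, h2, by omega⟩

lemma IsSumOf.coin_add {x k i : ℕ} (h1 : 1 ≤ i) (h2 : i ≤ n) (h3 : c i ≤ x)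
    (h : IsSumOf n c (x - c i) k) : IsSumOf n c x (k + 1) := by
  simpa [Nat.sub_add_cancel h3] using h.add (isSumOf_coin h1 h2)

lemma IsGreedySum.isSumOf {x k : ℕ} (h : IsGreedySum n c x k) : IsSumOf n c x k := by
  obtain ⟨γ, h1, h2⟩ := h
  exact ⟨γ, h1.1, h2⟩

lemma isGreedySum_zero (hc : IsCoinSystem n c) : IsGreedySum n c 0 0 :=
  ⟨0, ⟨by simp [IsRepr], fun i h1 h2 => by simpa using hc.pos (by omega) h2⟩, by simp [reprSize]⟩

lemma IsGreedySum.succ {x k j : ℕ} (hj : IsTopCoin n c x j)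
    (h : IsGreedySum n c (x - c j) k) : IsGreedySum n c x (k + 1) := by
  obtain ⟨γ, ⟨hr, hg⟩, hk⟩ := h
  obtain ⟨h1, h2, h3, h4⟩ := hj
  have hr' : IsRepr n c x (γ + Pi.single j 1) := by
    rw [← Nat.sub_add_cancel h3]
    exact (isRepr_add_single h1 h2).2 hr
  refine ⟨γ + Pi.single j 1, ⟨hr', fun i hi hin => ?_⟩, ?_⟩
  · rcases Nat.lt_or_ge j i with hji | hji
    · refine lt_of_le_of_lt ?_ (h4 i hji hin)
      rw [← hr']
      exact Finset.sum_le_sum_of_subset (Finset.Icc_subset_Icc le_rfl (show i - 1 ≤ n by omega))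
    · rw [sum_update_of_lt (by omega)]
      exact hg i hi hin
  · rw [reprSize_add_single h1 h2, hk]

lemma IsGreedySum.pred (hc : IsCoinSystem n c) {x k j : ℕ} (hj : IsTopCoin n c x j)
    (h : IsGreedySum n c x k) : ∃ l, k = l + 1 ∧ IsGreedySum n c (x - c j) l := by
  obtain ⟨γ, ⟨hr, hg⟩, hk⟩ := h
  obtain ⟨h1, h2, h3, h4⟩ := hj
  have hzero : ∀ i ∈ Finset.Icc 1 n, i ∉ Finset.Icc 1 j → γ i * c i = 0 := by
    intro i hi hij
    obtain ⟨hi1, hi2⟩ := Finset.mem_Icc.1 hi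
    have hji : j < i := by
      by_contra! h
      exact hij (Finset.mem_Icc.2 ⟨hi1, h⟩)
    have hle : γ i * c i ≤ x := by
      rw [← hr]
      exact Finset.single_le_sum (f := fun i => γ i * c i) (fun _ _ => Nat.zero_le _) hi
    have hlt := h4 i hji hi2
    rcases Nat.eq_zero_or_pos (γ i) with h0 | h0
    · simp [h0]
    · have := Nat.le_mul_of_pos_left (c i) h0
      omega
  have hsum : ∑ i ∈ Finset.Icc 1 j, γ i * c i = x := by
    rw [← hr]
    exact Finset.sum_subset (Finset.Icc_subset_Icc le_rfl h2) hzero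
  have hγ : γ j ≠ 0 := by
    intro h0
    obtain ⟨j, rfl⟩ : ∃ l, j = l + 1 := ⟨j - 1, by omega⟩
    rw [Finset.sum_Icc_succ_top (by omega), h0, zero_mul, add_zero] at hsum
    rcases Nat.eq_zero_or_pos j with rfl | hj
    · have := hc.pos h1 h2
      simp at hsum
      omega
    · have := hg (j + 1) (by omega) h2
      simp only [Nat.add_sub_cancel] at this
      omega
  have hsplit := eq_sub_add_single hγ
  have hr' : IsRepr n c (x - c j) (γ - Pi.single j 1) := by
    rw [hsplit, ← Nat.sub_add_cancel h3, isRepr_add_single h1 h2] at hr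
    exact hr
  rw [hsplit, reprSize_add_single h1 h2] at hk
  refine ⟨_, hk.symm, _, ⟨hr', fun i hi hin => lt_of_le_of_lt ?_ (hg i hi hin)⟩, rfl⟩
  exact Finset.sum_le_sum fun i _ => Nat.mul_le_mul_right _ (Nat.sub_le _ _)

lemma exists_isGreedySum (hc : IsCoinSystem n c) (hn : 1 ≤ n) (x : ℕ) :
    ∃ k, IsGreedySum n c x k := by
  induction x using Nat.strong_induction_on with
  | _ x ih =>
    rcases Nat.eq_zero_or_pos x with rfl | hx
    · exact ⟨0, isGreedySum_zero hc⟩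
    · obtain ⟨j, -, hj⟩ := exists_isTopCoin (c := c) (x := x) le_rfl hn (by rw [hc.1]; exact hx)
      have := hc.pos hj.1 hj.2.1
      obtain ⟨k, hk⟩ := ih (x - c j) (by omega)
      exact ⟨k + 1, hk.succ hj⟩

lemma IsGreedySum.unique (hc : IsCoinSystem n c) (hn : 1 ≤ n) {x k l : ℕ}
    (hk : IsGreedySum n c x k) (hl : IsGreedySum n c x l) : k = l := by
  induction x using Nat.strong_induction_on generalizing k l with
  | _ x ih =>
    rcases Nat.eq_zero_or_pos x with rfl | hx
    · rcases k with _ | k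
      · rcases l with _ | l
        · rfl
        · exact absurd (hl.isSumOf.pos hc) (lt_irrefl 0)
      · exact absurd (hk.isSumOf.pos hc) (lt_irrefl 0)
    · obtain ⟨j, -, hj⟩ := exists_isTopCoin (c := c) (x := x) le_rfl hn (by rw [hc.1]; exact hx)
      have := hc.pos hj.1 hj.2.1
      obtain ⟨k', rfl, hk'⟩ := hk.pred hc hj
      obtain ⟨l', rfl, hl'⟩ := hl.pred hc hj
      rw [ih (x - c j) (by omega) hk' hl']

lemma IsGreedySum.le_of_not_isCounterexample {x k l : ℕ} (hx : ¬ IsCounterexample n c x)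
    (hk : IsGreedySum n c x k) (hl : IsSumOf n c x l) : k ≤ l := by
  obtain ⟨γ, hγ, rfl⟩ := hk
  obtain ⟨β, hβ, rfl⟩ := hl
  by_contra! h
  exact hx ⟨γ, β, hγ, hβ, h⟩

lemma exists_isSumOf_of_le (hc : IsCoinSystem n c) (hn : 1 ≤ n) {x j k : ℕ}
    (hx : ¬ IsCounterexample n c x) (hj : IsTopCoin n c x j) (hk : IsSumOf n c x k) :
    ∃ l, l + 1 ≤ k ∧ IsGreedySum n c (x - c j) l := by
  obtain ⟨g, hg⟩ := exists_isGreedySum hc hn x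
  have hle := hg.le_of_not_isCounterexample hx hk
  obtain ⟨l, rfl, hl⟩ := hg.pred hc hj
  exact ⟨l, hle, hl⟩

/-- `x` is the smallest counterexample of `⟨c 1, …, c n⟩`, its optimal representations have
size `k` and its greedy representation has size `g`. -/
structure MinCounterexample (n : ℕ) (c : ℕ → ℕ) (x k g : ℕ) : Prop where
  not_lt : ∀ y, y < x → ¬ IsCounterexample n c y
  isSumOf : IsSumOf n c x k
  le_of_isSumOf : ∀ l, IsSumOf n c x l → k ≤ l
  greedy : IsGreedySum n c x g
  lt : k < g

lemma SmallestCounterexample.exists_sizes {x : ℕ} (h : SmallestCounterexample n c x) :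
    ∃ k g, MinCounterexample n c x k g := by
  classical
  obtain ⟨⟨γ, β, hγ, hβ, hlt⟩, hmin⟩ := h
  have hex : ∃ k, IsSumOf n c x k := ⟨_, β, hβ, rfl⟩
  exact ⟨Nat.find hex, _, hmin, Nat.find_spec hex, fun l hl => Nat.find_min' hex hl,
    ⟨γ, hγ, rfl⟩, (Nat.find_min' hex ⟨β, hβ, rfl⟩).trans_lt hlt⟩

namespace MinCounterexample

variable {x k g : ℕ}

lemma not_isSumOf_sub_top (hc : IsCoinSystem n c) (h : MinCounterexample n c x (k + 1) g)
    {j : ℕ} (hj : IsTopCoin n c x j) : ¬ IsSumOf n c (x - c j) k := by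
  intro hk
  obtain ⟨l, hl, hl'⟩ := h.greedy.pred hc hj
  have h1 := hc.pos hj.1 hj.2.1
  have h2 := hj.2.2.1
  have h3 := hl'.le_of_not_isCounterexample (h.not_lt _ (by omega)) hk
  have h4 := h.lt
  omega

/-- If a coin `c i` occurs in an optimal representation of the smallest counterexample `x` and
`c w ≤ x - c i`, then some coin of index at least `w` occurs as well, after a change of the
optimal representation. -/
lemma exists_coin_ge (hc : IsCoinSystem n c) (hn : 1 ≤ n)
    (h : MinCounterexample n c x (k + 1) g) {i w : ℕ} (hi : 1 ≤ i) (hin : i ≤ n)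
    (hix : c i ≤ x) (hk : IsSumOf n c (x - c i) k) (hw : 1 ≤ w) (hwn : w ≤ n)
    (hwx : c w ≤ x - c i) :
    ∃ j, w ≤ j ∧ j ≤ n ∧ c j ≤ x ∧ IsSumOf n c (x - c j) k := by
  obtain ⟨j, hwj, hj⟩ := exists_isTopCoin hw hwn hwx
  have hpos := hc.pos hi hin
  obtain ⟨l, hl, hl'⟩ := exists_isSumOf_of_le hc hn (h.not_lt (x - c i) (by omega)) hj hk
  have hjx := hj.2.2.1
  have hsum : IsSumOf n c (x - c j) (l + 1) := by
    refine IsSumOf.coin_add hi hin (by omega) ?_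
    rw [Nat.sub_right_comm]
    exact hl'.isSumOf
  have := h.le_of_isSumOf _ (hsum.coin_add hj.1 hj.2.1 (by omega))
  obtain rfl : k = l + 1 := by omega
  exact ⟨j, hwj, hj.2.1, by omega, hsum⟩

lemma lt_two_mul (hc : IsCoinSystem n c) (hn : 1 ≤ n) (h : MinCounterexample n c x k g) :
    x < 2 * c n := by
  by_contra! hx
  have hpos := hc.pos hn le_rfl
  rcases k with _ | k
  · have := h.isSumOf.eq_zero
    omega
  obtain ⟨i, h1, h2, h3, h4⟩ := h.isSumOf.exists_coin
  have hle := hc.le h1 h2 le_rfl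
  obtain ⟨j, hj1, hj2, -, hj4⟩ := h.exists_coin_ge hc hn h1 h2 h3 h4 hn le_rfl (by omega)
  obtain rfl : j = n := by omega
  exact h.not_isSumOf_sub_top hc (isTopCoin_last hn (by omega)) hj4

end MinCounterexample

lemma NonCanonical.exists_smallest (h : NonCanonical n c) :
    ∃ x, SmallestCounterexample n c x := by
  classical
  exact ⟨Nat.find h, Nat.find_spec h, fun _ hy => Nat.find_min h hy⟩

lemma IsCounterexample.of_lt_succ {m x : ℕ} (h : IsCounterexample m c x)
    (hx : x < c (m + 1)) : IsCounterexample (m + 1) c x := by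
  obtain ⟨γ, β, ⟨hγ, hg⟩, hβ, hlt⟩ := h
  have hcongr : ∀ f g : ℕ → ℕ, ∑ i ∈ Finset.Icc 1 m, (fun i => if i ≤ m then f i else 0) i * g i
      = ∑ i ∈ Finset.Icc 1 m, f i * g i := fun f g =>
    Finset.sum_congr rfl fun i hi => by simp [(Finset.mem_Icc.1 hi).2]
  have hrepr : ∀ f, IsRepr m c x f → IsRepr (m + 1) c x (fun i => if i ≤ m then f i else 0) := by
    intro f hf
    rw [IsRepr, Finset.sum_Icc_succ_top (by omega), hcongr, hf]
    simp
  have hsize : ∀ f, reprSize (m + 1) (fun i => if i ≤ m then f i else 0) = reprSize m f := by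
    intro f
    rw [reprSize, Finset.sum_Icc_succ_top (by omega)]
    simpa [reprSize] using hcongr f 1
  refine ⟨_, _, ⟨hrepr γ hγ, fun i hi him => ?_⟩, hrepr β hβ, by rwa [hsize, hsize]⟩
  rcases Nat.lt_or_ge m i with h | h
  · obtain rfl : i = m + 1 := by omega
    rw [Nat.add_sub_cancel, hcongr, hγ]
    exact hx
  · refine lt_of_le_of_lt (le_of_eq ?_) (hg i hi h)
    refine Finset.sum_congr rfl fun j hj => ?_
    have := (Finset.mem_Icc.1 hj).2
    simp [show j ≤ m by omega]

/-- In a tight system extending a non-canonical one by a coin, the new coin is less than twice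
the previous one. -/
lemma Tight.lt_two_mul {m : ℕ} (hm : 1 ≤ m) (hc : IsCoinSystem m c) (ht : Tight (m + 1) c)
    (hnon : NonCanonical m c) : c (m + 1) < 2 * c m := by
  obtain ⟨z, hz⟩ := hnon.exists_smallest
  obtain ⟨k, g, h⟩ := hz.exists_sizes
  have h1 := h.lt_two_mul hc hm
  by_contra! h2
  exact ht z (by omega) (hz.1.of_lt_succ (by omega))

/-- If no `c m + c i > c (m + 1)` is a counterexample, then every coin `c i` larger than
`c (m + 1) - c m` exceeds another coin by exactly that difference. -/
lemma exists_coin_eq_sub {m : ℕ} (hm : 1 ≤ m) (hc : IsCoinSystem (m + 1) c)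
    (hno : ∀ i, 1 ≤ i → i ≤ m + 1 → 1 < c i → c i ≤ c m →
      c (m + 1) < c m + c i → ¬ IsCounterexample (m + 1) c (c m + c i))
    {i : ℕ} (hi : 1 ≤ i) (him : i ≤ m) (h : c (m + 1) < c m + c i) :
    ∃ l, 1 ≤ l ∧ l ≤ m + 1 ∧ c l + c (m + 1) = c m + c i := by
  have h1 := hc.lt hm (m.lt_add_one) le_rfl
  have h2 := hc.le hi him (by omega)
  have htop : IsTopCoin (m + 1) c (c m + c i) (m + 1) := isTopCoin_last (by omega) h.le
  obtain ⟨l, hl, hl'⟩ := exists_isSumOf_of_le hc (by omega)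
    (hno i hi (by omega) (by omega) h2 h) htop
    ((isSumOf_coin hm (by omega)).add (isSumOf_coin hi (by omega)))
  have hsum := hl'.isSumOf
  obtain rfl | rfl : l = 0 ∨ l = 1 := by omega
  · have := hsum.eq_zero
    omega
  · obtain ⟨j, hj1, hj2, hj⟩ := hsum.exists_eq
    exact ⟨j, hj1, hj2, by omega⟩

namespace MinCounterexample

variable {m x k g : ℕ}

/-- The smallest counterexample is at least `2 * c (m + 1) - c m`. -/
lemma two_mul_le (hm : 1 ≤ m) (hc : IsCoinSystem (m + 1) c) (ht : Tight (m + 1) c)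
    (h2 : c (m + 1) < 2 * c m)
    (hno : ∀ i, 1 ≤ i → i ≤ m + 1 → 1 < c i → c i ≤ c m →
      c (m + 1) < c m + c i → ¬ IsCounterexample (m + 1) c (c m + c i))
    (h : MinCounterexample (m + 1) c x (k + 1) g) (hx : c (m + 1) ≤ x) :
    2 * c (m + 1) ≤ x + c m := by
  by_contra! hlt
  have hm1 : 1 ≤ m + 1 := by omega
  have hmm := hc.lt hm (m.lt_add_one) le_rfl
  have htop : IsTopCoin (m + 1) c x (m + 1) := isTopCoin_last hm1 hx
  have hsmall : ∀ i, 1 ≤ i → i ≤ m + 1 → c i ≤ x → IsSumOf (m + 1) c (x - c i) k →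
      c m + c i ≤ c (m + 1) := by
    intro i h1 h2 h3 h4
    by_contra! h5
    have him : i ≠ m + 1 := by
      rintro rfl
      exact h.not_isSumOf_sub_top hc htop h4
    obtain ⟨l, hl1, hl2, hl⟩ := exists_coin_eq_sub hm hc hno h1 (by omega) h5
    have hsum := h4.add (isSumOf_coin hl1 hl2)
    have htop' : IsTopCoin (m + 1) c (x - c i + c l) m :=
      ⟨hm, by omega, by omega, fun j hj hj' => by
        obtain rfl : j = m + 1 := by omega
        omega⟩
    obtain ⟨s, hs, hs'⟩ := exists_isSumOf_of_le hc hm1 (ht _ (by omega)) htop' hsum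
    obtain ⟨s', rfl, hs''⟩ := h.greedy.pred hc htop
    rw [show x - c i + c l - c m = x - c (m + 1) by omega] at hs'
    have := hs'.unique hc hm1 hs''
    have := h.lt
    omega
  obtain ⟨i, h1, h2, h3, h4⟩ := h.isSumOf.exists_coin
  have := hsmall i h1 h2 h3 h4
  obtain ⟨j, hj1, hj2, hj3, hj4⟩ := h.exists_coin_ge hc hm1 h1 h2 h3 h4 hm (by omega) (by omega)
  have := hsmall j (by omega) hj2 hj3 hj4
  have := hc.le hm hj1 hj2
  omega

lemma size_le_two (hm : 1 ≤ m) (hc : IsCoinSystem (m + 1) c) (ht : Tight (m + 1) c)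
    (h2 : c (m + 1) < 2 * c m)
    (hno : ∀ i, 1 ≤ i → i ≤ m + 1 → 1 < c i → c i ≤ c m →
      c (m + 1) < c m + c i → ¬ IsCounterexample (m + 1) c (c m + c i))
    (h : MinCounterexample (m + 1) c x k g) (hx : c (m + 1) ≤ x) : k ≤ 2 := by
  by_contra! hk
  obtain ⟨k, rfl⟩ : ∃ l, k = l + 1 + 1 + 1 := ⟨k - 3, by omega⟩
  have hm1 : 1 ≤ m + 1 := by omega
  have hmm := hc.lt hm (m.lt_add_one) le_rfl
  have htop : IsTopCoin (m + 1) c x (m + 1) := isTopCoin_last hm1 hx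
  have hge := h.two_mul_le hm hc ht h2 hno hx
  have key : ∀ t j, j + t = m + 1 → 1 ≤ j → c j ≤ x →
      ¬ IsSumOf (m + 1) c (x - c j) (k + 1 + 1) := by
    intro t
    induction t using Nat.strong_induction_on with
    | _ t ih =>
      intro j hjt hj hjx hjs
      rcases Nat.eq_zero_or_pos t with rfl | htpos
      · obtain rfl : j = m + 1 := by omega
        exact h.not_isSumOf_sub_top hc htop hjs
      obtain ⟨i, hi1, hi2, hix, his⟩ := hjs.exists_coin
      have hpos := his.pos hc
      have hij : c i + c j < c (m + 1) := by
        by_contra! hij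
        obtain ⟨s, hs, hs'⟩ := exists_isSumOf_of_le hc hm1 (h.not_lt (c i + c j) (by omega))
          (isTopCoin_last hm1 hij)
          ((isSumOf_coin hi1 hi2).add (isSumOf_coin hj (by omega)))
        have hsum := his.add hs'.isSumOf
        rw [show x - c j - c i + (c i + c j - c (m + 1)) = x - c (m + 1) by omega] at hsum
        have := h.le_of_isSumOf _ (hsum.coin_add hm1 le_rfl hx)
        obtain rfl : s = 1 := by omega
        exact h.not_isSumOf_sub_top hc htop hsum
      have hisum : IsSumOf (m + 1) c (x - c i) (k + 1 + 1) := by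
        refine IsSumOf.coin_add hj (by omega) (by omega) ?_
        rwa [Nat.sub_right_comm]
      have hlt : x - c i < c (j + 1) := by
        by_contra! hle
        obtain ⟨l, hl1, hl2, hl3, hl4⟩ := h.exists_coin_ge hc hm1 hi1 hi2 (by omega) hisum
          (by omega) (by omega) hle
        exact ih (m + 1 - l) (by omega) l (by omega) (by omega) hl3 hl4
      rcases Nat.lt_or_ge j m with hjm | hjm
      · rcases Nat.lt_or_ge (c (m + 1)) (c m + c (j + 1)) with hw | hw
        · obtain ⟨l, hl1, hl2, hl⟩ := exists_coin_eq_sub hm hc hno (by omega) (by omega) hw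
          have hlj : l ≤ j := by
            by_contra! hjl
            have := hc.le (by omega) (show j + 1 ≤ l from hjl) hl2
            omega
          have := hc.le hl1 hlj (by omega)
          omega
        · omega
      · obtain rfl : j = m := by omega
        omega
  obtain ⟨i, hi1, hi2, hi3, hi4⟩ := h.isSumOf.exists_coin
  exact key (m + 1 - i) i (by omega) hi1 hi3 hi4

end MinCounterexample

end

/-- Let `$₁ = ⟨1, c 2, c 3⟩`, `$₂ = ⟨1, …, c m⟩`, `$₃ = ⟨1, …, c m, c (m+1)⟩` be tight
coin systems with `$₁` canonical and `$₂`, `$₃` non-canonical. If `$₃` has no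
counterexample of the form `c m + c i > c (m+1)` or `c (m-1) + c j > c (m+1)` with
`1 < c i, c j ≤ c m`, then the smallest counterexample of `$₃` is the sum of two coins. -/
theorem stmt_17 (m : ℕ) (hm : 3 ≤ m) (c : ℕ → ℕ)
    (hc : IsCoinSystem (m + 1) c)
    (ht1 : Tight 3 c) (ht2 : Tight m c) (ht3 : Tight (m + 1) c)
    (hcan1 : IsCanonical 3 c) (hnon2 : NonCanonical m c)
    (hnon3 : NonCanonical (m + 1) c)
    (hno1 : ∀ i, 1 ≤ i → i ≤ m + 1 → 1 < c i → c i ≤ c m →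
      c (m + 1) < c m + c i → ¬ IsCounterexample (m + 1) c (c m + c i))
    (hno2 : ∀ j, 1 ≤ j → j ≤ m + 1 → 1 < c j → c j ≤ c m →
      c (m + 1) < c (m - 1) + c j → ¬ IsCounterexample (m + 1) c (c (m - 1) + c j)) :
    ∀ x, SmallestCounterexample (m + 1) c x →
      ∃ i j, 1 ≤ i ∧ i ≤ m + 1 ∧ 1 ≤ j ∧ j ≤ m + 1 ∧ x = c i + c j := by
  intro x hx
  obtain ⟨k, g, h⟩ := hx.exists_sizes
  have hge : c (m + 1) ≤ x := by
    by_contra! hlt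
    exact ht3 x hlt hx.1
  have hk := h.size_le_two (by omega) hc ht3
    (ht3.lt_two_mul (by omega) (hc.mono (by omega)) hnon2) hno1 hge
  have hpos := hc.pos (i := m + 1) (by omega) le_rfl
  have hsum := h.isSumOf
  rcases k with _ | _ | k
  · have := hsum.eq_zero
    omega
  · obtain ⟨i, hi1, hi2, rfl⟩ := hsum.exists_eq
    have hle := hc.le hi1 hi2 le_rfl
    refine absurd ?_ (h.not_isSumOf_sub_top hc (isTopCoin_last (by omega) hge))
    rw [Nat.sub_eq_zero_of_le hle]
    exact isSumOf_zero
  · obtain rfl : k = 0 := by omega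
    obtain ⟨i, hi1, hi2, hi3, hi4⟩ := hsum.exists_coin
    obtain ⟨j, hj1, hj2, hj⟩ := hi4.exists_eq
    exact ⟨i, j, hi1, hi2, hj1, hj2, by omega⟩
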